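/- Let β∈(0,1), s=s₁=0, and let u be twice continuously differentiable on [a,b]. Then there exist constants C₁,C₂>0, possibly depending on a, b, β, λ, g and the values of u, u′, u″ on [a,b], but independent of M and h, such that for every integer M≥3 the linear system H U_h = F has a unique solution U_h and ‖U−U_h‖ ≤ C₁ h^{2−β} and ‖U−U_h‖_∞ ≤ C₂ h^{2−β}. -/

import Mathlib

open MeasureTheory Set

noncomputable section

/-- Grid spacing `h = (b−a)/(M+1)`. -/
def gH (a b : ℝ) (M : ℕ) : ℝ := (b - a) / (M + 1)

/-- Grid points `x_i = a + i h`, `i = 0,…,M+1`. -/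
def gX (a b : ℝ) (M i : ℕ) : ℝ := a + i * gH a b M

/-- `A₁(i,s,k) = h^{−s−1} ∫_{x_{k−1}}^{x_k} (x_k−y)(x_i−y)^{s−1−β} dy`. -/
def cA1 (a b β : ℝ) (s M i k : ℕ) : ℝ :=
  gH a b M ^ (-(s : ℝ) - 1) *
    ∫ y in gX a b M (k - 1)..gX a b M k,
      (gX a b M k - y) * (gX a b M i - y) ^ ((s : ℝ) - 1 - β)

/-- `A₂(i,s,k) = h^{−s−1} ∫_{x_{k−1}}^{x_k} (y−x_{k−1})(x_i−y)^{s−1−β} dy`. -/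
def cA2 (a b β : ℝ) (s M i k : ℕ) : ℝ :=
  gH a b M ^ (-(s : ℝ) - 1) *
    ∫ y in gX a b M (k - 1)..gX a b M k,
      (y - gX a b M (k - 1)) * (gX a b M i - y) ^ ((s : ℝ) - 1 - β)

/-- `A₃(i,s,k) = h^{−s−1} ∫_{x_{k−1}}^{x_k} (x_k−y)(y−x_i)^{s−1−β} dy`. -/
def cA3 (a b β : ℝ) (s M i k : ℕ) : ℝ :=
  gH a b M ^ (-(s : ℝ) - 1) *
    ∫ y in gX a b M (k - 1)..gX a b M k,
      (gX a b M k - y) * (y - gX a b M i) ^ ((s : ℝ) - 1 - β)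

/-- `A₄(i,s,k) = h^{−s−1} ∫_{x_{k−1}}^{x_k} (y−x_{k−1})(y−x_i)^{s−1−β} dy`. -/
def cA4 (a b β : ℝ) (s M i k : ℕ) : ℝ :=
  gH a b M ^ (-(s : ℝ) - 1) *
    ∫ y in gX a b M (k - 1)..gX a b M k,
      (y - gX a b M (k - 1)) * (y - gX a b M i) ^ ((s : ℝ) - 1 - β)

/-- `B₁(i) = ∫_{−∞}^a e^{λ(y−x_i)} (x_i−y)^{−1−β} dy`. -/
def cB1 (a b β lam : ℝ) (M i : ℕ) : ℝ :=
  ∫ y in Iio a, Real.exp (lam * (y - gX a b M i)) * (gX a b M i - y) ^ (-1 - β)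

/-- `B₂(i) = ∫_b^∞ e^{λ(x_i−y)} (y−x_i)^{−1−β} dy`. -/
def cB2 (a b β lam : ℝ) (M i : ℕ) : ℝ :=
  ∫ y in Ioi b, Real.exp (lam * (gX a b M i - y)) * (y - gX a b M i) ^ (-1 - β)

/-- Off-diagonal entries `h_{i,j}` (in 1-based indexing, `1 ≤ i,j ≤ M`, `i ≠ j`) of the
stiffness matrix. -/
def offD (a b β lam : ℝ) (s s₁ M i j : ℕ) : ℝ :=
  if j + 2 ≤ i then
    -((cA1 a b β s M i (j + 1) + cA2 a b β s M i j) *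
        Real.exp (-lam * ((i : ℝ) - j) * gH a b M) * ((i : ℝ) - j) ^ (-(s : ℝ)))
  else if j + 1 = i then
    -(gH a b M ^ (-β) * Real.exp (-lam * gH a b M) / ((s₁ : ℝ) + 1 - β))
      - cA2 a b β s M i (i - 1) * Real.exp (-lam * gH a b M)
  else if j = i + 1 then
    -(gH a b M ^ (-β) * Real.exp (-lam * gH a b M) / ((s₁ : ℝ) + 1 - β))
      - cA3 a b β s M i (i + 2) * Real.exp (-lam * gH a b M)
  else if i + 2 ≤ j then
    -((cA3 a b β s M i (j + 1) + cA4 a b β s M i j) *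
        Real.exp (-lam * ((j : ℝ) - i) * gH a b M) * ((j : ℝ) - i) ^ (-(s : ℝ)))
  else 0

/-- The prescribed value of `h_{i,i} + Σ_{j≠i} h_{i,j} − B₁(i) − B₂(i)` (1-based index `i`). -/
def diagExtra (a b β lam : ℝ) (s s₁ M i : ℕ) : ℝ :=
  if i = 1 then
    gH a b M ^ (-β) * Real.exp (-lam * gH a b M) / ((s₁ : ℝ) + 1 - β)
      + cA4 a b β s M 1 (M + 1) * Real.exp (-lam * M * gH a b M) * (M : ℝ) ^ (-(s : ℝ))
  else if i = M then
    gH a b M ^ (-β) * Real.exp (-lam * gH a b M) / ((s₁ : ℝ) + 1 - β)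
      + cA1 a b β s M M 1 * Real.exp (-lam * M * gH a b M) * (M : ℝ) ^ (-(s : ℝ))
  else
    cA1 a b β s M i 1 * Real.exp (-lam * i * gH a b M) * (i : ℝ) ^ (-(s : ℝ))
      + cA4 a b β s M i (M + 1) * Real.exp (-lam * ((M : ℝ) + 1 - i) * gH a b M) *
          ((M : ℝ) + 1 - i) ^ (-(s : ℝ))

/-- The `M×M` stiffness matrix `H = (h_{i,j})`: off-diagonal entries given by `offD`, and
diagonal entries defined so that
`h_{i,i} + Σ_{j≠i} h_{i,j} − B₁(i) − B₂(i) = diagExtra i`. -/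
def stiff (a b β lam : ℝ) (s s₁ M : ℕ) : Matrix (Fin M) (Fin M) ℝ :=
  fun i j =>
    if i = j then
      cB1 a b β lam M (i.val + 1) + cB2 a b β lam M (i.val + 1)
        + diagExtra a b β lam s s₁ M (i.val + 1)
        - ∑ k ∈ Finset.univ.erase i, offD a b β lam s s₁ M (i.val + 1) (k.val + 1)
    else offD a b β lam s s₁ M (i.val + 1) (j.val + 1)

/-- `d₁(i) = ∫_{−∞}^a g(y) e^{−λ(x_i−y)} (x_i−y)^{−1−β} dy`. -/
def dd1 (a b β lam : ℝ) (g : ℝ → ℝ) (M i : ℕ) : ℝ :=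
  ∫ y in Iio a, g y * Real.exp (-lam * (gX a b M i - y)) * (gX a b M i - y) ^ (-1 - β)

/-- `d₂(i) = ∫_b^∞ g(y) e^{−λ(y−x_i)} (y−x_i)^{−1−β} dy`. -/
def dd2 (a b β lam : ℝ) (g : ℝ → ℝ) (M i : ℕ) : ℝ :=
  ∫ y in Ioi b, g y * Real.exp (-lam * (y - gX a b M i)) * (y - gX a b M i) ^ (-1 - β)

/-- The load vector `F`. -/
def loadF (a b β lam : ℝ) (s s₁ : ℕ) (f g u : ℝ → ℝ) (M : ℕ) : Fin M → ℝ :=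
  fun i =>
    f (gX a b M (i.val + 1)) + dd1 a b β lam g M (i.val + 1) + dd2 a b β lam g M (i.val + 1)
      + (if i.val + 1 = 1 then
            gH a b M ^ (-β) * Real.exp (-lam * gH a b M) / ((s₁ : ℝ) + 1 - β)
          else
            cA1 a b β s M (i.val + 1) 1 * Real.exp (-lam * ((i.val : ℝ) + 1) * gH a b M) *
              ((i.val : ℝ) + 1) ^ (-(s : ℝ))) * u a
      + (if i.val + 1 = M then
            gH a b M ^ (-β) * Real.exp (-lam * gH a b M) / ((s₁ : ℝ) + 1 - β)
          else
            cA4 a b β s M (i.val + 1) (M + 1) *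
              Real.exp (-lam * ((M : ℝ) - i.val) * gH a b M) *
              ((M : ℝ) - (i.val : ℝ)) ^ (-(s : ℝ))) * u b

/-- The discrete `L²` norm `‖v‖ = (h Σᵢ vᵢ²)^{1/2}`. -/
def dnorm2 (a b : ℝ) (M : ℕ) (v : Fin M → ℝ) : ℝ :=
  Real.sqrt (gH a b M * ∑ i, v i ^ 2)

end

noncomputable section

open MeasureTheory Set Filter

theorem abs_sub_linear_interp_le {w w' w'' : ℝ → ℝ} {c d K : ℝ} (hcd : c < d)
    (hw : ContinuousOn w (Icc c d))
    (hw' : ∀ y ∈ Ioo c d, HasDerivAt w (w' y) y)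
    (hw'' : ∀ y ∈ Ioo c d, HasDerivAt w' (w'' y) y)
    (hK : ∀ y ∈ Ioo c d, |w'' y| ≤ K) {y : ℝ} (hy : y ∈ Icc c d) :
    |w y - ((d - y) * w c + (y - c) * w d) / (d - c)| ≤ K / 2 * ((y - c) * (d - y)) := by
  have key : ∀ σ : ℝ, |σ| = 1 →
      σ * (w y - ((d - y) * w c + (y - c) * w d) / (d - c)) ≤ K / 2 * ((y - c) * (d - y)) := by
    intro σ hσ
    have hconv : ConvexOn ℝ (Icc c d) (fun t => σ * w t + K / 2 * t ^ 2) := by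
      refine convexOn_of_hasDerivWithinAt2_nonneg (f' := fun t => σ * w' t + K * t)
        (f'' := fun t => σ * w'' t + K) (convex_Icc c d) ?_ ?_ ?_ ?_
      · fun_prop
      · intro t ht
        rw [interior_Icc] at ht
        have h2 : HasDerivAt (fun t : ℝ => K / 2 * t ^ 2) (K * t) t := by
          exact ((hasDerivAt_pow 2 t).const_mul (K / 2)).congr_deriv (by norm_num; ring)
        exact (((hw' t ht).const_mul σ).add h2).hasDerivWithinAt
      · intro t ht
        rw [interior_Icc] at ht
        have h2 : HasDerivAt (fun t : ℝ => K * t) K t := by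
          simpa using (hasDerivAt_id t).const_mul K
        exact (((hw'' t ht).const_mul σ).add h2).hasDerivWithinAt
      · intro t ht
        rw [interior_Icc] at ht
        have h1 := hK t ht
        have h2 : |σ * w'' t| ≤ K := by rw [abs_mul, hσ, one_mul]; exact h1
        linarith [neg_abs_le (σ * w'' t)]
    have hpos : 0 < d - c := sub_pos.2 hcd
    have h := hconv.2 (left_mem_Icc.2 hcd.le) (right_mem_Icc.2 hcd.le)
      (div_nonneg (sub_nonneg.2 hy.2) hpos.le) (div_nonneg (sub_nonneg.2 hy.1) hpos.le)
      (by field_simp; ring)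
    have e : ((d - y) / (d - c)) • c + ((y - c) / (d - c)) • d = y := by
      simp only [smul_eq_mul]; field_simp; ring
    rw [e] at h
    simp only [smul_eq_mul] at h
    have e2 : (d - y) / (d - c) * (σ * w c + K / 2 * c ^ 2)
        + (y - c) / (d - c) * (σ * w d + K / 2 * d ^ 2) =
        σ * (((d - y) * w c + (y - c) * w d) / (d - c))
          + K / 2 * y ^ 2 + K / 2 * ((y - c) * (d - y)) := by
      field_simp; ring
    rw [e2] at h
    linarith
  rw [abs_le]
  constructor
  · linarith [key (-1) (by simp)]
  · linarith [key 1 (by simp)]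

theorem ContDiffOn.exists_bounded_derivs {a b : ℝ} (hab : a < b) {u : ℝ → ℝ}
    (hu : ContDiffOn ℝ 2 u (Icc a b)) :
    ∃ (u' u'' : ℝ → ℝ) (K : ℝ), 0 ≤ K ∧ (∀ y ∈ Ioo a b, HasDerivAt u (u' y) y) ∧
      (∀ y ∈ Ioo a b, HasDerivAt u' (u'' y) y) ∧
      (∀ y ∈ Icc a b, |u y| ≤ K ∧ |u' y| ≤ K ∧ |u'' y| ≤ K) ∧
      ∀ x ∈ Icc a b, ∀ y ∈ Icc a b, |u x - u y| ≤ K * |x - y| := by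
  have huniq := uniqueDiffOn_Icc hab
  have h1 : DifferentiableOn ℝ u (Icc a b) := hu.differentiableOn (by norm_num)
  have h2 : ContDiffOn ℝ 1 (derivWithin u (Icc a b)) (Icc a b) :=
    hu.derivWithin huniq (by norm_num)
  have h3 : ContinuousOn (derivWithin (derivWithin u (Icc a b)) (Icc a b)) (Icc a b) :=
    h2.continuousOn_derivWithin huniq le_rfl
  obtain ⟨K0, hK0⟩ := isCompact_Icc.exists_bound_of_continuousOn hu.continuousOn
  obtain ⟨K1, hK1⟩ := isCompact_Icc.exists_bound_of_continuousOn h2.continuousOn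
  obtain ⟨K2, hK2⟩ := isCompact_Icc.exists_bound_of_continuousOn h3
  refine ⟨derivWithin u (Icc a b), derivWithin (derivWithin u (Icc a b)) (Icc a b),
    max K0 (max K1 K2), ?_, ?_, ?_, ?_, ?_⟩
  · exact (norm_nonneg _).trans ((hK0 a (left_mem_Icc.2 hab.le)).trans (le_max_left _ _))
  · intro y hy
    exact (h1 y (Ioo_subset_Icc_self hy)).hasDerivWithinAt.hasDerivAt (Icc_mem_nhds hy.1 hy.2)
  · intro y hy
    exact (h2.differentiableOn (by norm_num) y
      (Ioo_subset_Icc_self hy)).hasDerivWithinAt.hasDerivAt (Icc_mem_nhds hy.1 hy.2)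
  · intro y hy
    exact ⟨(hK0 y hy).trans (le_max_left _ _),
      (hK1 y hy).trans ((le_max_left _ _).trans (le_max_right _ _)),
      (hK2 y hy).trans ((le_max_right _ _).trans (le_max_right _ _))⟩
  · intro x hx y hy
    exact (convex_Icc a b).norm_image_sub_le_of_norm_derivWithin_le (C := max K0 (max K1 K2)) h1
      (fun t ht => (hK1 t ht).trans ((le_max_left _ _).trans (le_max_right _ _))) hy hx

/-- The tempered increment `(u(x) - u(y)) e^{-λ|x-y|}`. -/
def temperedDiff (lam : ℝ) (u : ℝ → ℝ) (x y : ℝ) : ℝ :=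
  (u x - u y) * Real.exp (-lam * |x - y|)

theorem abs_temperedDiff_sub_interp_le {a b lam K : ℝ} (hlam : 0 ≤ lam) {u u' u'' : ℝ → ℝ}
    (huc : ContinuousOn u (Icc a b))
    (hu' : ∀ y ∈ Ioo a b, HasDerivAt u (u' y) y)
    (hu'' : ∀ y ∈ Ioo a b, HasDerivAt u' (u'' y) y)
    (hK : ∀ y ∈ Icc a b, |u y| ≤ K ∧ |u' y| ≤ K ∧ |u'' y| ≤ K)
    {x c d : ℝ} (hx : x ∈ Icc a b) (hac : a ≤ c) (hcd : c < d) (hdb : d ≤ b)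
    (hxcd : x ≤ c ∨ d ≤ x) {y : ℝ} (hy : y ∈ Icc c d) :
    |temperedDiff lam u x y -
        ((d - y) * temperedDiff lam u x c + (y - c) * temperedDiff lam u x d) / (d - c)|
      ≤ (K * (2 * lam ^ 2 + 2 * lam + 1)) / 2 * ((y - c) * (d - y)) := by
  have hsub : Icc c d ⊆ Icc a b := Icc_subset_Icc hac hdb
  have hsubo : Ioo c d ⊆ Ioo a b := Ioo_subset_Ioo hac hdb
  obtain ⟨σ, hσ, hσabs⟩ : ∃ σ : ℝ, σ ^ 2 = 1 ∧ ∀ t ∈ Icc c d, |x - t| = σ * (x - t) := by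
    rcases hxcd with h | h
    · exact ⟨-1, by norm_num, fun t ht => by rw [abs_of_nonpos (by linarith [ht.1])]; ring⟩
    · exact ⟨1, by norm_num, fun t ht => by rw [abs_of_nonneg (by linarith [ht.2])]; ring⟩
  have hσ1 : |σ| = 1 := by
    rcases sq_eq_one_iff.1 hσ with h | h <;> simp [h]
  set E : ℝ → ℝ := fun t => Real.exp (-lam * (σ * (x - t))) with hE
  have heq : ∀ t ∈ Icc c d, temperedDiff lam u x t = (u x - u t) * E t := by
    intro t ht
    rw [temperedDiff, hσabs t ht]
  have hEd : ∀ t, HasDerivAt E (σ * lam * E t) t := by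
    intro t
    have h1 : HasDerivAt (fun t : ℝ => -lam * (σ * (x - t))) (σ * lam) t := by
      exact ((((hasDerivAt_id t).const_sub x).const_mul σ).const_mul (-lam)).congr_deriv (by ring)
    exact h1.exp.congr_deriv (mul_comm _ _)
  have hE1 : ∀ t ∈ Icc c d, |E t| ≤ 1 := by
    intro t ht
    rw [hE, abs_of_pos (Real.exp_pos _), Real.exp_le_one_iff, ← hσabs t ht]
    nlinarith [abs_nonneg (x - t)]
  rw [heq y hy, heq c (left_mem_Icc.2 hcd.le), heq d (right_mem_Icc.2 hcd.le)]
  refine abs_sub_linear_interp_le (w := fun t => (u x - u t) * E t)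
    (w' := fun t => (-u' t) * E t + (u x - u t) * (σ * lam * E t))
    (w'' := fun t => ((-u'' t) * E t + (-u' t) * (σ * lam * E t)) +
      ((-u' t) * (σ * lam * E t) + (u x - u t) * (σ * lam * (σ * lam * E t))))
    hcd ?_ ?_ ?_ ?_ hy
  · exact (continuousOn_const.sub (huc.mono hsub)).mul
      (fun t _ => (hEd t).continuousAt.continuousWithinAt)
  · intro t ht
    exact ((hu' t (hsubo ht)).const_sub (u x)).mul (hEd t)
  · intro t ht
    exact ((hu'' t (hsubo ht)).neg.mul (hEd t)).add
      (((hu' t (hsubo ht)).const_sub (u x)).mul ((hEd t).const_mul (σ * lam)))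
  · intro t ht
    have htI := Ioo_subset_Icc_self ht
    obtain ⟨k0, k1, k2⟩ := hK t (hsub htI)
    have k3 := (hK x hx).1
    have hKn : 0 ≤ K := (abs_nonneg _).trans k0
    have e : ((-u'' t) * E t + (-u' t) * (σ * lam * E t)) +
      ((-u' t) * (σ * lam * E t) + (u x - u t) * (σ * lam * (σ * lam * E t))) =
      (-u'' t - 2 * (σ * lam) * u' t + lam ^ 2 * u x - lam ^ 2 * u t) * E t := by
      linear_combination (u x - u t) * lam ^ 2 * E t * hσ
    rw [e, abs_mul]
    have b1 : |2 * (σ * lam) * u' t| ≤ 2 * lam * K := by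
      rw [abs_mul, abs_mul, abs_mul, hσ1, abs_of_nonneg hlam]
      simp only [Nat.abs_ofNat, one_mul]
      gcongr
    have b2 : |lam ^ 2 * u x| ≤ lam ^ 2 * K := by
      rw [abs_mul, abs_of_nonneg (sq_nonneg lam)]; gcongr
    have b3 : |lam ^ 2 * u t| ≤ lam ^ 2 * K := by
      rw [abs_mul, abs_of_nonneg (sq_nonneg lam)]; gcongr
    have b4 : |-u'' t - 2 * (σ * lam) * u' t + lam ^ 2 * u x - lam ^ 2 * u t|
        ≤ K * (2 * lam ^ 2 + 2 * lam + 1) := by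
      rw [abs_le] at *
      constructor <;> linarith [b1.1, b1.2, b2.1, b2.2, b3.1, b3.2, k2.1, k2.2]
    calc _ ≤ K * (2 * lam ^ 2 + 2 * lam + 1) * 1 := by
          gcongr
          exact hE1 t htI
      _ = _ := mul_one _

theorem isUnit_and_abs_le_of_rowSum {n : ℕ} (H : Matrix (Fin n) (Fin n) ℝ) {c : ℝ} (hc : 0 < c)
    (hoff : ∀ i j, i ≠ j → H i j ≤ 0) (hrow : ∀ i, c ≤ ∑ j, H i j) :
    IsUnit H ∧ ∀ (v : Fin n → ℝ) (R : ℝ), (∀ i, |H.mulVec v i| ≤ R) → ∀ i, c * |v i| ≤ R := by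
  have key : ∀ (v : Fin n → ℝ) (R : ℝ), (∀ i, |H.mulVec v i| ≤ R) → ∀ i, c * |v i| ≤ R := by
    intro v R hR i
    have : Nonempty (Fin n) := ⟨i⟩
    obtain ⟨k, hk⟩ := Finite.exists_max (fun j => |v j|)
    have hdiff : ∀ s : ℝ, |s| = 1 → s * v k = |v k| → c * |v k| ≤ s * H.mulVec v k := by
      intro s hs hsk
      have h1 : s * H.mulVec v k = ∑ j, H k j * (s * v j) := by
        rw [Matrix.mulVec, dotProduct, Finset.mul_sum]
        exact Finset.sum_congr rfl fun j _ => by ring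
      have h2 : ∑ j, H k j * |v k| ≤ ∑ j, H k j * (s * v j) := by
        refine Finset.sum_le_sum fun j _ => ?_
        by_cases hj : k = j
        · subst hj; rw [hsk]
        · refine mul_le_mul_of_nonpos_left ?_ (hoff k j hj)
          calc s * v j ≤ |s * v j| := le_abs_self _
            _ = |v j| := by rw [abs_mul, hs, one_mul]
            _ ≤ |v k| := hk j
      rw [h1]
      refine le_trans ?_ h2
      rw [← Finset.sum_mul]
      exact mul_le_mul_of_nonneg_right (hrow k) (abs_nonneg _)
    have hk2 : c * |v k| ≤ R := by
      rcases le_total 0 (v k) with h | h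
      · have := hdiff 1 (by simp) (by rw [abs_of_nonneg h, one_mul])
        linarith [le_abs_self (H.mulVec v k), hR k]
      · have := hdiff (-1) (by simp) (by rw [abs_of_nonpos h]; ring)
        linarith [neg_abs_le (H.mulVec v k), hR k]
    exact (mul_le_mul_of_nonneg_left (hk i) hc.le).trans hk2
  refine ⟨?_, key⟩
  rw [← Matrix.mulVec_injective_iff_isUnit]
  intro v w hvw
  funext i
  have h0 : ∀ i, |H.mulVec (v - w) i| ≤ 0 := by
    intro i
    have : H.mulVec v = H.mulVec w := hvw
    rw [Matrix.mulVec_sub, this]; simp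
  have := key (v - w) 0 h0 i
  have h3 : |(v - w) i| ≤ 0 := by
    by_contra! hcon
    linarith [mul_pos hc hcon]
  have h4 := abs_nonpos_iff.1 h3
  simpa [sub_eq_zero] using h4

theorem intervalIntegrable_abs_sub_rpow {r : ℝ} (hr : -1 < r) (x c d : ℝ) :
    IntervalIntegrable (fun y => |x - y| ^ r) volume c d := by
  have h0 : ∀ z : ℝ, IntervalIntegrable (fun t : ℝ => |t| ^ r) volume 0 z := by
    intro z
    rcases le_total 0 z with h | h
    · refine (intervalIntegral.intervalIntegrable_rpow' hr (a := 0) (b := z)).congr ?_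
      intro t ht
      rw [uIoc_of_le h] at ht
      simp only [abs_of_pos ht.1]
    · have h1 : IntervalIntegrable (fun t : ℝ => t ^ r) volume 0 (-z) :=
        intervalIntegral.intervalIntegrable_rpow' hr
      have h2 := h1.comp_sub_left 0
      simp only [sub_zero, zero_sub, sub_neg_eq_add, zero_add] at h2
      refine h2.congr ?_
      intro t ht
      rw [uIoc_of_ge h] at ht
      simp only [abs_of_nonpos ht.2]
  have h1 : IntervalIntegrable (fun t : ℝ => |t| ^ r) volume (x - c) (x - d) :=
    (h0 _).symm.trans (h0 _)
  simpa using h1.comp_sub_left x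

theorem integral_mul_abs_rpow {β h : ℝ} (hβ : β < 1) (hh : 0 < h) :
    ∫ t in (0)..h, t * |t| ^ (-1 - β) = h ^ (1 - β) / (1 - β) := by
  have : ∫ t in (0)..h, t * |t| ^ (-1 - β) = ∫ t in (0)..h, t ^ (-β) := by
    refine intervalIntegral.integral_congr_ae (ae_of_all _ fun t ht => ?_)
    rw [uIoc_of_le hh.le] at ht
    rw [abs_of_pos ht.1]
    nth_rewrite 1 [← Real.rpow_one t]
    rw [← Real.rpow_add ht.1]
    ring_nf
  rw [this, integral_rpow (Or.inl (by linarith)), Real.zero_rpow (by linarith)]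
  ring_nf

theorem intervalIntegrable_mul_abs_rpow {β h : ℝ} (hβ : β < 1) (hh : 0 < h) :
    IntervalIntegrable (fun t => t * |t| ^ (-1 - β)) volume 0 h := by
  refine (intervalIntegral.intervalIntegrable_rpow' (a := 0) (b := h)
    (r := -β) (by linarith)).congr ?_
  intro t ht
  rw [uIoc_of_le hh.le] at ht
  simp only
  rw [abs_of_pos ht.1]
  nth_rewrite 2 [← Real.rpow_one t]
  rw [← Real.rpow_add ht.1]
  ring_nf

theorem integral_min_mul_rpow_le {β h L : ℝ} (hβ : β ∈ Ioo (0 : ℝ) 1) (hh : 0 < h) (hL : h ≤ L) :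
    ∫ t in (0)..L, min h |t| * |t| ^ (-1 - β) ≤ h ^ (1 - β) * (1 / (1 - β) + 1 / β) := by
  obtain ⟨h0, h1⟩ := hβ
  have hnear : ∀ t ∈ uIoc 0 h, t * |t| ^ (-1 - β) = min h |t| * |t| ^ (-1 - β) := by
    intro t ht
    rw [uIoc_of_le hh.le] at ht
    rw [abs_of_pos ht.1, min_eq_right ht.2]
  have e1 : ∫ t in (0)..h, min h |t| * |t| ^ (-1 - β) = h ^ (1 - β) / (1 - β) := by
    rw [← integral_mul_abs_rpow h1 hh]
    exact intervalIntegral.integral_congr_ae (ae_of_all _ fun t ht => (hnear t ht).symm)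
  have hcong : ∀ t ∈ uIcc h L, min h |t| * |t| ^ (-1 - β) = h * t ^ (-1 - β) := by
    intro t ht
    rw [uIcc_of_le hL] at ht
    rw [abs_of_pos (hh.trans_le ht.1), min_eq_left ht.1]
  have e2 : ∫ t in h..L, min h |t| * |t| ^ (-1 - β) = (h ^ (1 - β) - h * L ^ (-β)) / β := by
    rw [intervalIntegral.integral_congr hcong, intervalIntegral.integral_const_mul,
      integral_rpow (Or.inr ⟨by linarith, by
        rw [uIcc_of_le hL]; exact fun h' => absurd h'.1 (not_le.2 hh)⟩)]
    have : h ^ (1 - β) = h * h ^ (-β) := by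
      rw [sub_eq_add_neg, Real.rpow_add hh, Real.rpow_one]
    rw [this]
    have e : -1 - β + 1 = -β := by ring
    rw [e]
    field_simp
    ring
  have i1 : IntervalIntegrable (fun t => min h |t| * |t| ^ (-1 - β)) volume 0 h :=
    (intervalIntegrable_mul_abs_rpow h1 hh).congr hnear
  have i2 : IntervalIntegrable (fun t => min h |t| * |t| ^ (-1 - β)) volume h L := by
    refine ContinuousOn.intervalIntegrable ?_
    refine ContinuousOn.mul (by fun_prop) (ContinuousOn.rpow_const (by fun_prop) ?_)
    intro t ht
    rw [uIcc_of_le hL] at ht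
    exact Or.inl (abs_ne_zero.2 (hh.trans_le ht.1).ne')
  rw [← intervalIntegral.integral_add_adjacent_intervals i1 i2, e1, e2]
  have : 0 ≤ h * L ^ (-β) := mul_nonneg hh.le (Real.rpow_nonneg (hh.le.trans hL) _)
  have : (h ^ (1 - β) - h * L ^ (-β)) / β ≤ h ^ (1 - β) / β := by gcongr; linarith
  calc _ ≤ h ^ (1 - β) / (1 - β) + h ^ (1 - β) / β := by linarith
    _ = _ := by ring

theorem intervalIntegrable_min_mul_rpow {β h : ℝ} (hβ : β ∈ Ioo (0 : ℝ) 1) (hh : 0 < h)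
    (x c d : ℝ) :
    IntervalIntegrable (fun y => min h |x - y| * |x - y| ^ (-1 - β)) volume c d := by
  refine (intervalIntegrable_abs_sub_rpow (r := -β) (by linarith [hβ.2]) x c d).mono_fun' ?_ ?_
  · exact Measurable.aestronglyMeasurable (by fun_prop)
  · refine ae_of_all _ fun y => ?_
    have hn : 0 ≤ |x - y| ^ (-1 - β) := Real.rpow_nonneg (abs_nonneg _) _
    simp only [Real.norm_eq_abs]
    rw [abs_of_nonneg (mul_nonneg (le_min hh.le (abs_nonneg _)) hn)]
    rcases (abs_nonneg (x - y)).eq_or_lt with h0 | h0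
    · rw [← h0]
      simp [hh.le, Real.zero_rpow_nonneg]
    · calc _ ≤ |x - y| * |x - y| ^ (-1 - β) := by gcongr; exact min_le_right _ _
        _ = _ := by
          nth_rewrite 1 [← Real.rpow_one |x - y|]
          rw [← Real.rpow_add h0]
          ring_nf

theorem integral_min_mul_rpow_sub_le {a b x β h : ℝ} (hβ : β ∈ Ioo (0 : ℝ) 1) (hh : 0 < h)
    (hxa : h ≤ x - a) (hxb : h ≤ b - x) :
    ∫ y in a..b, min h |x - y| * |x - y| ^ (-1 - β)
      ≤ 2 * (h ^ (1 - β) * (1 / (1 - β) + 1 / β)) := by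
  rw [← intervalIntegral.integral_add_adjacent_intervals
    (intervalIntegrable_min_mul_rpow hβ hh x a x) (intervalIntegrable_min_mul_rpow hβ hh x x b)]
  have e1 := intervalIntegral.integral_comp_sub_left (a := a) (b := x)
    (fun t => min h |t| * |t| ^ (-1 - β)) x
  have e2 := intervalIntegral.integral_comp_sub_right (a := x) (b := b)
    (fun t => min h |t| * |t| ^ (-1 - β)) x
  simp only [sub_self, abs_sub_comm _ x] at e1 e2
  rw [e1, e2]
  linarith [integral_min_mul_rpow_le hβ hh hxa, integral_min_mul_rpow_le hβ hh hxb]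

theorem integrableOn_exp_mul_rpow_Ioi {lam β x b : ℝ} (hlam : 0 ≤ lam) (hβ : 0 < β) (hxb : x < b) :
    IntegrableOn (fun y => Real.exp (-lam * |x - y|) * |x - y| ^ (-1 - β)) (Ioi b) := by
  have h := integrableOn_add_rpow_Ioi_of_lt (a := -1 - β) (c := b) (m := -x) (by linarith)
    (by linarith)
  refine Integrable.mono' h (Measurable.aestronglyMeasurable (by fun_prop)) ?_
  refine (ae_restrict_iff' measurableSet_Ioi).2 (ae_of_all _ fun y hy => ?_)
  have hy' : 0 < y - x := by linarith [mem_Ioi.1 hy]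
  have e : |x - y| = y + -x := by rw [abs_sub_comm, abs_of_pos hy']; ring
  have hn : 0 ≤ |x - y| ^ (-1 - β) := Real.rpow_nonneg (abs_nonneg _) _
  rw [Real.norm_eq_abs, abs_mul, abs_of_pos (Real.exp_pos _), abs_of_nonneg hn, ← e]
  refine mul_le_of_le_one_left hn ?_
  rw [Real.exp_le_one_iff]
  nlinarith [abs_nonneg (x - y)]

theorem integrableOn_exp_mul_rpow_Iio {lam β x a : ℝ} (hlam : 0 ≤ lam) (hβ : 0 < β) (hax : a < x) :
    IntegrableOn (fun y => Real.exp (-lam * |x - y|) * |x - y| ^ (-1 - β)) (Iio a) := by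
  have h := (integrableOn_exp_mul_rpow_Ioi (x := -x) (b := -a) hlam hβ (by linarith)).comp_neg_Iio
  refine h.congr_fun ?_ measurableSet_Iio
  intro y _
  have : |-x - -y| = |x - y| := by rw [← abs_neg]; ring_nf
  simp only [this]

theorem integrableOn_temperedDiff_mul_rpow {a b β lam K x : ℝ} (hβ : β ∈ Ioo (0 : ℝ) 1)
    (hlam : 0 ≤ lam) {u : ℝ → ℝ} (huc : ContinuousOn u (Icc a b)) (hx : x ∈ Icc a b)
    (hlip : ∀ x ∈ Icc a b, ∀ y ∈ Icc a b, |u x - u y| ≤ K * |x - y|) :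
    IntegrableOn (fun y => temperedDiff lam u x y * |x - y| ^ (-1 - β)) (Icc a b) := by
  have hab : a ≤ b := hx.1.trans hx.2
  have h0 := ((intervalIntegrable_abs_sub_rpow (r := -β) (by linarith [hβ.2]) x a b).const_mul K)
  rw [intervalIntegrable_iff_integrableOn_Icc_of_le hab] at h0
  refine Integrable.mono' h0 ?_ ?_
  · refine AEStronglyMeasurable.mul ?_ (Measurable.aestronglyMeasurable (by fun_prop))
    refine ContinuousOn.aestronglyMeasurable ?_ measurableSet_Icc
    unfold temperedDiff
    fun_prop
  · refine (ae_restrict_iff' measurableSet_Icc).2 (ae_of_all _ fun y hy => ?_)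
    have hn : 0 ≤ |x - y| ^ (-1 - β) := Real.rpow_nonneg (abs_nonneg _) _
    have he : Real.exp (-lam * |x - y|) ≤ 1 := by
      rw [Real.exp_le_one_iff]; nlinarith [abs_nonneg (x - y)]
    rw [Real.norm_eq_abs, abs_mul, abs_of_nonneg hn, temperedDiff, abs_mul,
      abs_of_pos (Real.exp_pos _)]
    have h1 := hlip x hx y hy
    rcases (abs_nonneg (x - y)).eq_or_lt with h0 | h0
    · rw [← h0] at h1 ⊢
      have : |u x - u y| = 0 := le_antisymm (by simpa using h1) (abs_nonneg _)
      rw [this, Real.zero_rpow (by linarith [hβ.1] : -β ≠ 0)]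
      simp
    · calc |u x - u y| * Real.exp (-lam * |x - y|) * |x - y| ^ (-1 - β)
          ≤ |u x - u y| * 1 * |x - y| ^ (-1 - β) := by gcongr
        _ ≤ K * |x - y| * |x - y| ^ (-1 - β) := by rw [mul_one]; gcongr
        _ = K * |x - y| ^ (-β) := by
          nth_rewrite 1 [← Real.rpow_one |x - y|]
          rw [mul_assoc, ← Real.rpow_add h0]
          ring_nf

theorem eq_integral_of_tendsto_truncated {G : ℝ → ℝ} {x l : ℝ} (hG : Integrable G)
    (hl : Tendsto (fun ε : ℝ => ∫ y in {y : ℝ | ε < |x - y|}, G y)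
      (nhdsWithin 0 (Ioi 0)) (nhds l)) : l = ∫ y, G y := by
  refine tendsto_nhds_unique hl ?_
  have hm : ∀ ε : ℝ, MeasurableSet {y : ℝ | ε < |x - y|} := fun ε =>
    measurableSet_lt measurable_const (by fun_prop)
  simp only [← integral_indicator (hm _)]
  refine tendsto_integral_filter_of_dominated_convergence (fun y => ‖G y‖) ?_ ?_ hG.norm ?_
  · exact Eventually.of_forall fun ε => hG.aestronglyMeasurable.indicator (hm ε)
  · exact Eventually.of_forall fun ε => ae_of_all _ fun y => norm_indicator_le_norm_self _ _
  · have hne : ∀ᵐ y : ℝ, y ≠ x := by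
      simp [ae_iff, measure_singleton]
    filter_upwards [hne] with y hy
    refine tendsto_const_nhds.congr' ?_
    have hpos : 0 < |x - y| := abs_pos.2 (sub_ne_zero.2 hy.symm)
    filter_upwards [nhdsWithin_le_nhds (Iio_mem_nhds hpos)] with ε hε
    rw [indicator_of_mem]
    exact hε

theorem eq_integral_temperedDiff_add {a b β lam K x fx : ℝ} (hβ : β ∈ Ioo (0 : ℝ) 1)
    (hlam : 0 ≤ lam) {u g : ℝ → ℝ} (huc : ContinuousOn u (Icc a b)) (hx : x ∈ Ioo a b)
    (hlip : ∀ x ∈ Icc a b, ∀ y ∈ Icc a b, |u x - u y| ≤ K * |x - y|)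
    (hg : Measurable g) (hug : ∀ x, x ∉ Ioo a b → u x = g x)
    (hgint : IntegrableOn (fun y => |g y| * Real.exp (-lam * |x - y|) * |x - y| ^ (-1 - β))
        (Ioo a b)ᶜ volume)
    (hf : Tendsto
        (fun ε : ℝ => ∫ y in {y : ℝ | ε < |x - y|},
          (u x - u y) * Real.exp (-lam * |x - y|) * |x - y| ^ (-1 - β))
        (nhdsWithin 0 (Ioi 0)) (nhds fx)) :
    fx = (∫ y in a..b, temperedDiff lam u x y * |x - y| ^ (-1 - β)) +
      (u x * (∫ y in Iio a, Real.exp (lam * (y - x)) * (x - y) ^ (-1 - β)) -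
        ∫ y in Iio a, g y * Real.exp (-lam * (x - y)) * (x - y) ^ (-1 - β)) +
      (u x * (∫ y in Ioi b, Real.exp (lam * (x - y)) * (y - x) ^ (-1 - β)) -
        ∫ y in Ioi b, g y * Real.exp (-lam * (y - x)) * (y - x) ^ (-1 - β)) := by
  set G : ℝ → ℝ := fun y => temperedDiff lam u x y * |x - y| ^ (-1 - β) with hGdef
  have hab : a < b := hx.1.trans hx.2
  have hmid : IntegrableOn G (Icc a b) :=
    integrableOn_temperedDiff_mul_rpow hβ hlam huc (Ioo_subset_Icc_self hx) hlip
  have hgint' : IntegrableOn (fun y => g y * Real.exp (-lam * |x - y|) * |x - y| ^ (-1 - β))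
      (Ioo a b)ᶜ := by
    refine Integrable.mono' hgint (Measurable.aestronglyMeasurable (by fun_prop)) ?_
    refine ae_of_all _ fun y => ?_
    rw [Real.norm_eq_abs, abs_mul, abs_mul, abs_of_pos (Real.exp_pos _),
      abs_of_nonneg (Real.rpow_nonneg (abs_nonneg _) _)]
  have hsL : Iio a ⊆ (Ioo a b)ᶜ := fun y hy h => lt_asymm h.1 hy
  have hsR : Ioi b ⊆ (Ioo a b)ᶜ := fun y hy h => lt_asymm h.2 hy
  have hkL := integrableOn_exp_mul_rpow_Iio (x := x) hlam hβ.1 hx.1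
  have hkR := integrableOn_exp_mul_rpow_Ioi (x := x) hlam hβ.1 hx.2
  have hGout : ∀ y ∈ (Ioo a b)ᶜ, u x * (Real.exp (-lam * |x - y|) * |x - y| ^ (-1 - β)) -
      g y * Real.exp (-lam * |x - y|) * |x - y| ^ (-1 - β) = G y := by
    intro y hy
    simp only [hGdef, temperedDiff, hug y hy]
    ring
  have hL : IntegrableOn G (Iio a) :=
    IntegrableOn.congr_fun ((hkL.const_mul (u x)).sub (hgint'.mono_set hsL))
      (fun y hy => hGout y (hsL hy)) measurableSet_Iio
  have hR : IntegrableOn G (Ioi b) :=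
    IntegrableOn.congr_fun ((hkR.const_mul (u x)).sub (hgint'.mono_set hsR))
      (fun y hy => hGout y (hsR hy)) measurableSet_Ioi
  have hLI : IntegrableOn G (Iic b) := by
    rw [← Iio_union_Icc_eq_Iic hab.le]
    exact hL.union hmid
  have hG : Integrable G := by
    rw [← integrableOn_univ, ← Iic_union_Ioi (a := b)]
    exact hLI.union hR
  have h1 : fx = ∫ y, G y := eq_integral_of_tendsto_truncated hG hf
  have hIL : ∫ y in Iio a, G y =
      u x * (∫ y in Iio a, Real.exp (lam * (y - x)) * (x - y) ^ (-1 - β)) -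
        ∫ y in Iio a, g y * Real.exp (-lam * (x - y)) * (x - y) ^ (-1 - β) := by
    rw [← setIntegral_congr_fun measurableSet_Iio fun y hy => hGout y (hsL hy),
      integral_sub (hkL.const_mul (u x)) (hgint'.mono_set hsL), integral_const_mul]
    have hp : ∀ y ∈ Iio a, |x - y| = x - y := fun y hy =>
      abs_of_pos (by linarith [mem_Iio.1 hy, hx.1])
    congr 1
    · congr 1
      refine setIntegral_congr_fun measurableSet_Iio fun y hy => ?_
      simp only [hp y hy]
      ring_nf
    · refine setIntegral_congr_fun measurableSet_Iio fun y hy => ?_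
      simp only [hp y hy]
  have hIR : ∫ y in Ioi b, G y =
      u x * (∫ y in Ioi b, Real.exp (lam * (x - y)) * (y - x) ^ (-1 - β)) -
        ∫ y in Ioi b, g y * Real.exp (-lam * (y - x)) * (y - x) ^ (-1 - β) := by
    rw [← setIntegral_congr_fun measurableSet_Ioi fun y hy => hGout y (hsR hy),
      integral_sub (hkR.const_mul (u x)) (hgint'.mono_set hsR), integral_const_mul]
    have hp : ∀ y ∈ Ioi b, |x - y| = y - x := fun y hy => by
      rw [abs_sub_comm]
      exact abs_of_pos (by linarith [mem_Ioi.1 hy, hx.2])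
    congr 1
    · congr 1
      refine setIntegral_congr_fun measurableSet_Ioi fun y hy => ?_
      simp only [hp y hy]
      ring_nf
    · refine setIntegral_congr_fun measurableSet_Ioi fun y hy => ?_
      simp only [hp y hy]
  have hsplit : ∫ y, G y = (∫ y in Iio a, G y) + (∫ y in Icc a b, G y) + ∫ y in Ioi b, G y := by
    rw [← setIntegral_univ, ← Iic_union_Ioi (a := b),
      setIntegral_union (Iic_disjoint_Ioi le_rfl) measurableSet_Ioi hLI hR,
      ← Iio_union_Icc_eq_Iic hab.le,
      setIntegral_union ?_ measurableSet_Icc hL hmid]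
    exact Set.disjoint_left.2 fun y hy hy' => not_le.2 hy hy'.1
  rw [h1, hsplit, hIL, hIR, integral_Icc_eq_integral_Ioc, ← intervalIntegral.integral_of_le hab.le]
  ring

theorem gH_pos {a b : ℝ} (hab : a < b) (M : ℕ) : 0 < gH a b M :=
  div_pos (sub_pos.2 hab) (by positivity)

theorem gX_zero (a b : ℝ) (M : ℕ) : gX a b M 0 = a := by simp [gX]

theorem gX_last (a b : ℝ) (M : ℕ) : gX a b M (M + 1) = b := by
  have : (M : ℝ) + 1 ≠ 0 := by positivity
  simp only [gX, gH]
  push_cast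
  field_simp
  ring

theorem gX_sub_gX (a b : ℝ) (M i j : ℕ) :
    gX a b M i - gX a b M j = ((i : ℝ) - j) * gH a b M := by
  simp only [gX]; ring

theorem gX_succ (a b : ℝ) (M m : ℕ) : gX a b M (m + 1) = gX a b M m + gH a b M := by
  simp only [gX]; push_cast; ring

theorem gX_mono {a b : ℝ} (hab : a < b) (M : ℕ) : StrictMono (gX a b M) :=
  strictMono_nat_of_lt_succ fun m => by
    rw [gX_succ]; linarith [gH_pos hab M]

/-- Quadrature weight of the left endpoint of the cell `[x_m, x_{m+1}]`, for the singular
kernel centred at `x_i` (with `s = s₁ = 0`). -/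
def leftWeight (a b β : ℝ) (M i m : ℕ) : ℝ :=
  if m + 2 ≤ i then cA1 a b β 0 M i (m + 1)
  else if m + 1 = i then gH a b M ^ (-β) / (1 - β)
  else if m = i then 0
  else cA3 a b β 0 M i (m + 1)

/-- Quadrature weight of the right endpoint of the cell `[x_m, x_{m+1}]`, for the singular
kernel centred at `x_i` (with `s = s₁ = 0`). -/
def rightWeight (a b β : ℝ) (M i m : ℕ) : ℝ :=
  if m + 2 ≤ i then cA2 a b β 0 M i (m + 1)
  else if m + 1 = i then 0
  else if m = i then gH a b M ^ (-β) / (1 - β)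
  else cA4 a b β 0 M i (m + 1)

theorem cA_nonneg {a b β : ℝ} (hab : a < b) (M i m : ℕ) :
    (m + 2 ≤ i → 0 ≤ cA1 a b β 0 M i (m + 1) ∧ 0 ≤ cA2 a b β 0 M i (m + 1)) ∧
    (i < m → 0 ≤ cA3 a b β 0 M i (m + 1) ∧ 0 ≤ cA4 a b β 0 M i (m + 1)) := by
  have hh := gH_pos hab M
  have hmono := gX_mono hab M
  have hle : gX a b M (m + 1 - 1) ≤ gX a b M (m + 1) := hmono.monotone (by omega)
  refine ⟨fun h => ?_, fun h => ?_⟩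
  · have h1 := hmono (show m + 1 < i by omega)
    constructor
    · refine mul_nonneg (Real.rpow_nonneg hh.le _) (intervalIntegral.integral_nonneg hle ?_)
      intro y hy
      exact mul_nonneg (by linarith [hy.2]) (Real.rpow_nonneg (by linarith [hy.2]) _)
    · refine mul_nonneg (Real.rpow_nonneg hh.le _) (intervalIntegral.integral_nonneg hle ?_)
      intro y hy
      exact mul_nonneg (by linarith [hy.1]) (Real.rpow_nonneg (by linarith [hy.2]) _)
  · have h1 := hmono (show i < m + 1 - 1 by omega)
    constructor
    · refine mul_nonneg (Real.rpow_nonneg hh.le _) (intervalIntegral.integral_nonneg hle ?_)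
      intro y hy
      exact mul_nonneg (by linarith [hy.2]) (Real.rpow_nonneg (by linarith [hy.1]) _)
    · refine mul_nonneg (Real.rpow_nonneg hh.le _) (intervalIntegral.integral_nonneg hle ?_)
      intro y hy
      exact mul_nonneg (by linarith [hy.1]) (Real.rpow_nonneg (by linarith [hy.1]) _)

theorem weights_nonneg {a b β : ℝ} (hab : a < b) (hβ : β < 1) (M i m : ℕ) :
    0 ≤ leftWeight a b β M i m ∧ 0 ≤ rightWeight a b β M i m := by
  have hnear : 0 ≤ gH a b M ^ (-β) / (1 - β) :=
    div_nonneg (Real.rpow_nonneg (gH_pos hab M).le _) (by linarith)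
  obtain ⟨h1, h2⟩ := cA_nonneg (β := β) hab M i m
  unfold leftWeight rightWeight
  split_ifs with c1 c2 c3
  · exact h1 c1
  · exact ⟨hnear, le_rfl⟩
  · exact ⟨le_rfl, hnear⟩
  · exact h2 (by omega)

theorem integral_interp_mul_eq {k : ℝ → ℝ} {c d p q : ℝ} (hk : ContinuousOn k (uIcc c d)) :
    IntervalIntegrable (fun y => ((d - y) * p + (y - c) * q) / (d - c) * k y) volume c d ∧
    ∫ y in c..d, ((d - y) * p + (y - c) * q) / (d - c) * k y =
      ((d - c)⁻¹ * ∫ y in c..d, (d - y) * k y) * p +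
        ((d - c)⁻¹ * ∫ y in c..d, (y - c) * k y) * q := by
  constructor
  · exact ContinuousOn.intervalIntegrable (by fun_prop)
  · have i1 : IntervalIntegrable (fun y => (d - y) * k y) volume c d :=
      ContinuousOn.intervalIntegrable (by fun_prop)
    have i2 : IntervalIntegrable (fun y => (y - c) * k y) volume c d :=
      ContinuousOn.intervalIntegrable (by fun_prop)
    have : ∀ y, ((d - y) * p + (y - c) * q) / (d - c) * k y =
        ((d - c)⁻¹ * p) * ((d - y) * k y) + ((d - c)⁻¹ * q) * ((y - c) * k y) := by
      intro y; rw [div_eq_mul_inv]; ring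
    simp only [this]
    rw [intervalIntegral.integral_add (i1.const_mul _) (i2.const_mul _),
      intervalIntegral.integral_const_mul, intervalIntegral.integral_const_mul]
    ring

theorem integral_interp_mul_kernel {a b β : ℝ} (hab : a < b) (hβ : β < 1) (M i m : ℕ) {p q : ℝ}
    (hp : m = i → p = 0) (hq : m + 1 = i → q = 0) :
    IntervalIntegrable (fun y => ((gX a b M (m + 1) - y) * p + (y - gX a b M m) * q) /
      (gX a b M (m + 1) - gX a b M m) * |gX a b M i - y| ^ (-1 - β)) volume
        (gX a b M m) (gX a b M (m + 1)) ∧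
    ∫ y in gX a b M m..gX a b M (m + 1), ((gX a b M (m + 1) - y) * p + (y - gX a b M m) * q) /
      (gX a b M (m + 1) - gX a b M m) * |gX a b M i - y| ^ (-1 - β) =
      leftWeight a b β M i m * p + rightWeight a b β M i m * q := by
  have hh := gH_pos hab M
  have hmono := gX_mono hab M
  have hle : gX a b M m ≤ gX a b M (m + 1) := hmono.monotone (by omega)
  have hd : gX a b M (m + 1) - gX a b M m = gH a b M := by rw [gX_succ]; ring
  have hfar : i < m ∨ m + 2 ≤ i → ContinuousOn (fun y => |gX a b M i - y| ^ (-1 - β))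
      (uIcc (gX a b M m) (gX a b M (m + 1))) := by
    intro hi
    refine ContinuousOn.rpow_const (by fun_prop) fun y hy => Or.inl (abs_ne_zero.2 ?_)
    rw [uIcc_of_le hle] at hy
    rcases hi with hi | hi
    · have := hmono hi
      intro h0; linarith [hy.1]
    · have := hmono (show m + 1 < i by omega)
      intro h0; linarith [hy.2]
  have hpow : gH a b M ^ (-β) = gH a b M ^ (1 - β) / gH a b M := by
    rw [sub_eq_add_neg, Real.rpow_add hh, Real.rpow_one]
    field_simp
  have hI := integral_mul_abs_rpow hβ hh
  have hII := intervalIntegrable_mul_abs_rpow hβ hh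
  unfold leftWeight rightWeight
  split_ifs with c1 c2 c3
  · obtain ⟨h1, h2⟩ := integral_interp_mul_eq (p := p) (q := q) (hfar (Or.inr c1))
    refine ⟨h1, h2.trans ?_⟩
    have hx := hmono (show m + 1 < i by omega)
    have hab : ∀ y ∈ uIcc (gX a b M m) (gX a b M (m + 1)), |gX a b M i - y| = gX a b M i - y := by
      intro y hy
      rw [uIcc_of_le hle] at hy
      exact abs_of_pos (by linarith [hy.2])
    simp only [cA1, cA2, hd, Nat.cast_zero, neg_zero, zero_sub, Real.rpow_neg_one,
      Nat.add_sub_cancel]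
    congr 3
    · exact intervalIntegral.integral_congr fun y hy => by simp only [hab y hy]
    · exact intervalIntegral.integral_congr fun y hy => by simp only [hab y hy]
  · subst c2
    rw [hq rfl, hd]
    have e : ∀ y, ((gX a b M (m + 1) - y) * p + (y - gX a b M m) * 0) / gH a b M *
        |gX a b M (m + 1) - y| ^ (-1 - β) =
        p / gH a b M * ((gX a b M (m + 1) - y) * |gX a b M (m + 1) - y| ^ (-1 - β)) := by
      intro y; ring
    simp only [e]
    have e1 := intervalIntegral.integral_comp_sub_left (a := gX a b M m) (b := gX a b M (m + 1))
      (fun t => t * |t| ^ (-1 - β)) (gX a b M (m + 1))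
    rw [sub_self, hd, hI] at e1
    constructor
    · have := hII.comp_sub_left (gX a b M (m + 1))
      rw [← hd] at this
      simpa using (this.const_mul (p / gH a b M)).symm
    · rw [intervalIntegral.integral_const_mul, e1, hpow]
      ring
  · subst c3
    rw [hp rfl, hd]
    have e : ∀ y, ((gX a b M (m + 1) - y) * 0 + (y - gX a b M m) * q) / gH a b M *
        |gX a b M m - y| ^ (-1 - β) =
        q / gH a b M * ((y - gX a b M m) * |y - gX a b M m| ^ (-1 - β)) := by
      intro y; rw [abs_sub_comm]; ring
    simp only [e]
    have e1 := intervalIntegral.integral_comp_sub_right (a := gX a b M m) (b := gX a b M (m + 1))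
      (fun t => t * |t| ^ (-1 - β)) (gX a b M m)
    rw [sub_self, hd, hI] at e1
    constructor
    · have := hII.comp_sub_right (gX a b M m)
      rw [← hd] at this
      simpa using this.const_mul (q / gH a b M)
    · rw [intervalIntegral.integral_const_mul, e1, hpow]
      ring
  · have hi : i < m := by omega
    obtain ⟨h1, h2⟩ := integral_interp_mul_eq (p := p) (q := q) (hfar (Or.inl hi))
    refine ⟨h1, h2.trans ?_⟩
    have hx := hmono hi
    have hab : ∀ y ∈ uIcc (gX a b M m) (gX a b M (m + 1)), |gX a b M i - y| = y - gX a b M i := by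
      intro y hy
      rw [uIcc_of_le hle] at hy
      rw [abs_sub_comm]
      exact abs_of_pos (by linarith [hy.1])
    simp only [cA3, cA4, hd, Nat.cast_zero, neg_zero, zero_sub, Real.rpow_neg_one,
      Nat.add_sub_cancel]
    congr 3
    · exact intervalIntegral.integral_congr fun y hy => by simp only [hab y hy]
    · exact intervalIntegral.integral_congr fun y hy => by simp only [hab y hy]

theorem abs_integral_sub_quadrature_le {a b β C : ℝ} (hab : a < b) (hβ : β ∈ Ioo (0 : ℝ) 1)
    (hC : 0 ≤ C) (M i : ℕ) (hi : 1 ≤ i) (hiM : i ≤ M) {Φ : ℝ → ℝ} (hΦ0 : Φ (gX a b M i) = 0)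
    (hint : IntegrableOn (fun y => Φ y * |gX a b M i - y| ^ (-1 - β)) (Icc a b))
    (hinterp : ∀ c d, a ≤ c → c < d → d ≤ b → (gX a b M i ≤ c ∨ d ≤ gX a b M i) →
      ∀ y ∈ Icc c d,
        |Φ y - ((d - y) * Φ c + (y - c) * Φ d) / (d - c)| ≤ C / 2 * ((y - c) * (d - y))) :
    |∑ m ∈ Finset.range (M + 1), (leftWeight a b β M i m * Φ (gX a b M m) +
        rightWeight a b β M i m * Φ (gX a b M (m + 1))) -
      ∫ y in a..b, Φ y * |gX a b M i - y| ^ (-1 - β)|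
      ≤ C * (1 / (1 - β) + 1 / β) * gH a b M ^ (2 - β) := by
  have hh := gH_pos hab M
  have hmono := gX_mono hab M
  set x := gX a b M i with hx
  set h := gH a b M with hhdef
  have hcell : ∀ m < M + 1, a ≤ gX a b M m ∧ gX a b M (m + 1) ≤ b := by
    intro m hm
    constructor
    · exact (gX_zero a b M).symm.trans_le (hmono.monotone (Nat.zero_le _))
    · exact (hmono.monotone (by omega)).trans_eq (gX_last a b M)
  have hΦint : ∀ m < M + 1, IntervalIntegrable (fun y => Φ y * |x - y| ^ (-1 - β)) volume
      (gX a b M m) (gX a b M (m + 1)) := by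
    intro m hm
    rw [intervalIntegrable_iff_integrableOn_Icc_of_le (hmono.monotone (by omega))]
    exact hint.mono_set (Icc_subset_Icc (hcell m hm).1 (hcell m hm).2)
  have s1 := intervalIntegral.sum_integral_adjacent_intervals hΦint
  have s2 := intervalIntegral.sum_integral_adjacent_intervals (a := gX a b M) (n := M + 1)
    (fun m _ => intervalIntegrable_min_mul_rpow hβ hh x (gX a b M m) (gX a b M (m + 1)))
  rw [gX_zero, gX_last] at s1 s2
  rw [← s1, ← Finset.sum_sub_distrib]
  have hone : ∀ m ∈ Finset.range (M + 1),
      |leftWeight a b β M i m * Φ (gX a b M m) + rightWeight a b β M i m * Φ (gX a b M (m + 1)) -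
        ∫ y in gX a b M m..gX a b M (m + 1), Φ y * |x - y| ^ (-1 - β)| ≤
      C / 2 * h * ∫ y in gX a b M m..gX a b M (m + 1), min h |x - y| * |x - y| ^ (-1 - β) := by
    intro m hm
    rw [Finset.mem_range] at hm
    obtain ⟨j1, j2⟩ := integral_interp_mul_kernel hab hβ.2 M i m (p := Φ (gX a b M m))
      (q := Φ (gX a b M (m + 1))) (fun h => by rw [h, hΦ0]) (fun h => by rw [h, hΦ0])
    have hd : gX a b M (m + 1) - gX a b M m = h := by rw [gX_succ]; ring
    have hlt : gX a b M m < gX a b M (m + 1) := hmono (by omega)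
    rw [← j2, ← intervalIntegral.integral_sub j1 (hΦint m hm), ← Real.norm_eq_abs,
      ← intervalIntegral.integral_const_mul]
    refine intervalIntegral.norm_integral_le_of_norm_le hlt.le (ae_of_all _ fun y hy => ?_)
      ((intervalIntegrable_min_mul_rpow hβ hh x _ _).const_mul _)
    have hyI := Ioc_subset_Icc_self hy
    have hxcd : x ≤ gX a b M m ∨ gX a b M (m + 1) ≤ x := by
      rcases le_or_gt i m with h1 | h1
      · exact Or.inl (hmono.monotone h1)
      · exact Or.inr (hmono.monotone h1)
    have hb := hinterp _ _ (hcell m hm).1 hlt (hcell m hm).2 hxcd y hyI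
    have hn : 0 ≤ |x - y| ^ (-1 - β) := Real.rpow_nonneg (abs_nonneg _) _
    have hprod : (y - gX a b M m) * (gX a b M (m + 1) - y) ≤ h * min h |x - y| := by
      rcases hxcd with h1 | h1
      · have : y - gX a b M m ≤ min h |x - y| := by
          refine le_min (by linarith [hyI.2]) ?_
          rw [abs_sub_comm]
          exact le_trans (by linarith) (le_abs_self _)
        calc _ ≤ min h |x - y| * h := mul_le_mul this (by linarith [hyI.1])
              (by linarith [hyI.2]) (le_min hh.le (abs_nonneg _))
          _ = _ := mul_comm _ _
      · have : gX a b M (m + 1) - y ≤ min h |x - y| := by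
          refine le_min (by linarith [hyI.1]) ?_
          exact le_trans (by linarith) (le_abs_self _)
        exact mul_le_mul (by linarith [hyI.2]) this (by linarith [hyI.2]) hh.le
    rw [← sub_mul, Real.norm_eq_abs, abs_mul, abs_of_nonneg hn, abs_sub_comm]
    calc _ ≤ C / 2 * ((y - gX a b M m) * (gX a b M (m + 1) - y)) * |x - y| ^ (-1 - β) := by
          gcongr
      _ ≤ C / 2 * (h * min h |x - y|) * |x - y| ^ (-1 - β) := by gcongr
      _ = _ := by ring
  refine (Finset.abs_sum_le_sum_abs _ _).trans ((Finset.sum_le_sum hone).trans ?_)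
  rw [← Finset.mul_sum, s2]
  have hxa : h ≤ x - a := by
    have := hmono.monotone hi
    rw [gX_succ, gX_zero] at this
    linarith
  have hxb : h ≤ b - x := by
    have := hmono.monotone (show i + 1 ≤ M + 1 by omega)
    rw [gX_succ, gX_last] at this
    linarith
  calc _ ≤ C / 2 * h * (2 * (h ^ (1 - β) * (1 / (1 - β) + 1 / β))) := by
        gcongr
        exact integral_min_mul_rpow_sub_le hβ hh hxa hxb
    _ = C * (1 / (1 - β) + 1 / β) * (h * h ^ (1 - β)) := by ring
    _ = _ := by
        nth_rewrite 1 [← Real.rpow_one h]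
        rw [← Real.rpow_add hh]
        ring_nf

theorem offD_eq (a b β lam : ℝ) (M i j : ℕ) (hij : i ≠ j + 1) :
    offD a b β lam 0 0 M i (j + 1) =
      -((leftWeight a b β M i (j + 1) + rightWeight a b β M i j) *
        Real.exp (-lam * |(i : ℝ) - (j + 1 : ℕ)| * gH a b M)) := by
  have habs1 : j + 1 ≤ i → |(i : ℝ) - (j + 1 : ℕ)| = (i : ℝ) - (j + 1 : ℕ) := fun h =>
    abs_of_nonneg (sub_nonneg.2 (by exact_mod_cast h))
  have habs2 : i ≤ j + 1 → |(i : ℝ) - (j + 1 : ℕ)| = ((j + 1 : ℕ) : ℝ) - i := fun h => by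
    rw [abs_sub_comm]
    exact abs_of_nonneg (sub_nonneg.2 (by exact_mod_cast h))
  unfold offD leftWeight rightWeight
  rcases lt_trichotomy (j + 2) i with h | h | h
  · rw [if_pos (by omega), if_pos (by omega), if_pos (by omega), habs1 (by omega)]
    simp
  · subst h
    rw [if_neg (by omega), if_pos (by omega), if_neg (by omega), if_pos (by omega),
      if_pos (by omega), habs1 (by omega)]
    have : ((j + 2 : ℕ) : ℝ) - (j + 1 : ℕ) = 1 := by push_cast; ring
    rw [this]
    simp only [show j + 2 - 1 = j + 1 from rfl, Nat.cast_zero, zero_add]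
    ring_nf
  · rcases eq_or_lt_of_le (show i ≤ j by omega) with h' | h'
    · subst h'
      rw [if_neg (by omega), if_neg (by omega), if_pos rfl, if_neg (by omega), if_neg (by omega),
        if_neg (by omega), if_neg (by omega), if_neg (by omega), if_pos rfl, habs2 (by omega)]
      have : ((i + 1 : ℕ) : ℝ) - i = 1 := by push_cast; ring
      rw [this]
      simp only [Nat.cast_zero, zero_add]
      ring_nf
    · rw [if_neg (by omega), if_neg (by omega), if_neg (by omega), if_pos (by omega),
        if_neg (by omega), if_neg (by omega), if_neg (by omega), if_neg (by omega),
        if_neg (by omega), if_neg (by omega), habs2 (by omega)]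
      simp

theorem diagExtra_eq (a b β lam : ℝ) (M i : ℕ) (hM : 3 ≤ M) (hi : 1 ≤ i) (hiM : i ≤ M) :
    diagExtra a b β lam 0 0 M i =
      leftWeight a b β M i 0 * Real.exp (-lam * |(i : ℝ) - (0 : ℕ)| * gH a b M) +
      rightWeight a b β M i M * Real.exp (-lam * |(i : ℝ) - (M + 1 : ℕ)| * gH a b M) := by
  have habs1 : |(i : ℝ) - (0 : ℕ)| = i := by simp
  have habs2 : |(i : ℝ) - (M + 1 : ℕ)| = (M : ℝ) + 1 - i := by
    rw [abs_sub_comm, abs_of_nonneg (sub_nonneg.2 (by exact_mod_cast (by omega)))]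
    push_cast; ring
  rw [habs1, habs2]
  unfold diagExtra leftWeight rightWeight
  by_cases h1 : i = 1
  · subst h1
    rw [if_pos rfl, if_neg (by omega), if_pos (by omega), if_neg (by omega), if_neg (by omega),
      if_neg (by omega)]
    simp
    ring
  · rw [if_neg h1]
    by_cases h2 : i = M
    · subst h2
      rw [if_pos rfl, if_pos (by omega), if_neg (by omega), if_neg (by omega), if_pos rfl]
      simp
      ring
    · rw [if_neg h2, if_pos (by omega), if_neg (by omega), if_neg (by omega), if_neg (by omega)]
      simp

theorem loadF_eq (a b β lam : ℝ) (f g u : ℝ → ℝ) (M : ℕ) (i : Fin M) :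
    loadF a b β lam 0 0 f g u M i =
      f (gX a b M (i.val + 1)) + dd1 a b β lam g M (i.val + 1) + dd2 a b β lam g M (i.val + 1)
      + leftWeight a b β M (i.val + 1) 0 *
          Real.exp (-lam * |((i.val + 1 : ℕ) : ℝ) - (0 : ℕ)| * gH a b M) * u a
      + rightWeight a b β M (i.val + 1) M *
          Real.exp (-lam * |((i.val + 1 : ℕ) : ℝ) - (M + 1 : ℕ)| * gH a b M) * u b := by
  have hi := i.isLt
  have habs1 : |((i.val + 1 : ℕ) : ℝ) - (0 : ℕ)| = (i.val : ℝ) + 1 := by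
    rw [Nat.cast_zero, sub_zero, Nat.abs_cast]; push_cast; ring
  have habs2 : |((i.val + 1 : ℕ) : ℝ) - (M + 1 : ℕ)| = (M : ℝ) - i.val := by
    rw [abs_sub_comm, abs_of_nonneg (sub_nonneg.2 (by exact_mod_cast (by omega)))]
    push_cast; ring
  rw [habs1, habs2]
  unfold loadF leftWeight rightWeight
  congr 1
  · congr 2
    by_cases h1 : i.val + 1 = 1
    · rw [if_pos h1, if_neg (by omega), if_pos (by omega)]
      have : (i.val : ℝ) = 0 := by exact_mod_cast (by omega : i.val = 0)
      simp [this]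
      ring
    · rw [if_neg h1, if_pos (by omega)]
      simp
  · congr 1
    by_cases h2 : i.val + 1 = M
    · rw [if_pos h2, if_neg (by omega), if_neg (by omega), if_pos h2.symm]
      have : (M : ℝ) - i.val = 1 := by
        have : (i.val : ℝ) + 1 = M := by exact_mod_cast h2
        linarith
      rw [this]
      simp
      ring
    · rw [if_neg h2, if_neg (by omega), if_neg (by omega), if_neg (by omega)]
      simp

theorem stiff_rowSum (a b β lam : ℝ) (M : ℕ) (i : Fin M) :
    ∑ j, stiff a b β lam 0 0 M i j = cB1 a b β lam M (i.val + 1) + cB2 a b β lam M (i.val + 1)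
        + diagExtra a b β lam 0 0 M (i.val + 1) := by
  rw [← Finset.add_sum_erase _ _ (Finset.mem_univ i)]
  have : ∑ j ∈ Finset.univ.erase i, stiff a b β lam 0 0 M i j =
      ∑ j ∈ Finset.univ.erase i, offD a b β lam 0 0 M (i.val + 1) (j.val + 1) :=
    Finset.sum_congr rfl fun j hj => if_neg (Finset.ne_of_mem_erase hj).symm
  rw [this]
  simp [stiff]

theorem stiff_mulVec (a b β lam : ℝ) (M : ℕ) (i : Fin M) (v : ℕ → ℝ) :
    (stiff a b β lam 0 0 M).mulVec (fun j => v (j.val + 1)) i =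
      (cB1 a b β lam M (i.val + 1) + cB2 a b β lam M (i.val + 1)
        + diagExtra a b β lam 0 0 M (i.val + 1)) * v (i.val + 1) +
      ∑ j ∈ Finset.range M,
        (leftWeight a b β M (i.val + 1) (j + 1) + rightWeight a b β M (i.val + 1) j) *
        (Real.exp (-lam * |((i.val + 1 : ℕ) : ℝ) - (j + 1 : ℕ)| * gH a b M) *
          (v (i.val + 1) - v (j + 1))) := by
  rw [← stiff_rowSum, Finset.sum_mul, Finset.sum_range, ← Finset.sum_add_distrib,
    Matrix.mulVec, dotProduct]
  refine Finset.sum_congr rfl fun j _ => ?_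
  by_cases hij : i = j
  · subst hij; ring
  · have : stiff a b β lam 0 0 M i j = offD a b β lam 0 0 M (i.val + 1) (j.val + 1) := if_neg hij
    rw [this, offD_eq _ _ _ _ _ _ _ (fun h => hij (Fin.ext (by omega)))]
    ring

theorem sum_cells_eq (p q φ : ℕ → ℝ) (M : ℕ) :
    ∑ m ∈ Finset.range (M + 1), (p m * φ m + q m * φ (m + 1)) =
      p 0 * φ 0 + q M * φ (M + 1) + ∑ j ∈ Finset.range M, (p (j + 1) + q j) * φ (j + 1) := by
  rw [Finset.sum_add_distrib, Finset.sum_range_succ', Finset.sum_range_succ]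
  simp only [add_mul, Finset.sum_add_distrib]
  ring

theorem cB1_ge {a b β lam : ℝ} (hβ : 0 < β) (hlam : 0 ≤ lam) (M i : ℕ)
    (hx : gX a b M i ∈ Ioo a b) :
    Real.exp (-lam * (b - a + 1)) * (b - a + 1) ^ (-1 - β) ≤ cB1 a b β lam M i := by
  set x := gX a b M i with hxdef
  have hint : IntegrableOn (fun y => Real.exp (lam * (y - x)) * (x - y) ^ (-1 - β)) (Iio a) := by
    refine (integrableOn_exp_mul_rpow_Iio (x := x) hlam hβ hx.1).congr_fun ?_ measurableSet_Iio
    intro y hy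
    have : |x - y| = x - y := abs_of_pos (by linarith [mem_Iio.1 hy, hx.1])
    simp only [this]
    ring_nf
  have hsub : Ioo (a - 1) a ⊆ Iio a := Ioo_subset_Iio_self
  have hconst : Real.exp (-lam * (b - a + 1)) * (b - a + 1) ^ (-1 - β) =
      ∫ _ in Ioo (a - 1) a, Real.exp (-lam * (b - a + 1)) * (b - a + 1) ^ (-1 - β) := by
    simp
  rw [hconst, cB1, ← hxdef]
  refine (setIntegral_mono_on (integrableOn_const (by simp)) (hint.mono_set hsub) measurableSet_Ioo ?_).trans
    (setIntegral_mono_set hint ?_ hsub.eventuallyLE)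
  · intro y hy
    refine mul_le_mul ?_ ?_ (Real.rpow_nonneg (by linarith [hx.1, hx.2]) _) (Real.exp_pos _).le
    · rw [Real.exp_le_exp]
      nlinarith [hy.1, hx.2]
    · exact Real.rpow_le_rpow_of_nonpos (by linarith [hy.2, hx.1]) (by linarith [hy.1, hx.2])
        (by linarith)
  · refine (ae_restrict_iff' measurableSet_Iio).2 (ae_of_all _ fun y hy => ?_)
    exact mul_nonneg (Real.exp_pos _).le
      (Real.rpow_nonneg (by linarith [mem_Iio.1 hy, hx.1]) _)

theorem cB2_nonneg {a b β lam : ℝ} (M i : ℕ) (hx : gX a b M i ∈ Ioo a b) :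
    0 ≤ cB2 a b β lam M i := by
  refine setIntegral_nonneg measurableSet_Ioi fun y hy => ?_
  exact mul_nonneg (Real.exp_pos _).le
    (Real.rpow_nonneg (by linarith [mem_Ioi.1 hy, hx.2]) _)

theorem gX_mem_Ioo {a b : ℝ} (hab : a < b) {M i : ℕ} (hi : 1 ≤ i) (hiM : i ≤ M) :
    gX a b M i ∈ Ioo a b := by
  have hmono := gX_mono hab M
  exact ⟨(gX_zero a b M).symm.trans_lt (hmono (by omega)),
    (hmono (by omega)).trans_eq (gX_last a b M)⟩

theorem stiff_isUnit_and_abs_le {a b β lam : ℝ} (hab : a < b) (hβ : β ∈ Ioo (0 : ℝ) 1)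
    (hlam : 0 ≤ lam) {M : ℕ} (hM : 3 ≤ M) :
    IsUnit (stiff a b β lam 0 0 M) ∧ ∀ (v : Fin M → ℝ) (R : ℝ),
      (∀ i, |(stiff a b β lam 0 0 M).mulVec v i| ≤ R) →
      ∀ i, Real.exp (-lam * (b - a + 1)) * (b - a + 1) ^ (-1 - β) * |v i| ≤ R := by
  refine isUnit_and_abs_le_of_rowSum _
    (mul_pos (Real.exp_pos _) (Real.rpow_pos_of_pos (by linarith) _)) ?_ ?_
  · intro i j hij
    have : stiff a b β lam 0 0 M i j = offD a b β lam 0 0 M (i.val + 1) (j.val + 1) := if_neg hij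
    rw [this, offD_eq _ _ _ _ _ _ _ (fun h => hij (Fin.ext (by omega))), neg_nonpos]
    exact mul_nonneg (add_nonneg (weights_nonneg hab hβ.2 _ _ _).1
      (weights_nonneg hab hβ.2 _ _ _).2) (Real.exp_pos _).le
  · intro i
    have hx := gX_mem_Ioo hab (M := M) (i := i.val + 1) (by omega) (by omega)
    rw [stiff_rowSum, diagExtra_eq _ _ _ _ _ _ hM (by omega) (by omega)]
    have h1 := cB1_ge hβ.1 hlam M _ hx
    have h2 := cB2_nonneg (β := β) (lam := lam) M _ hx
    have h3 := mul_nonneg (weights_nonneg hab hβ.2 M (i.val + 1) 0).1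
      (Real.exp_pos (-lam * |((i.val + 1 : ℕ) : ℝ) - (0 : ℕ)| * gH a b M)).le
    have h4 := mul_nonneg (weights_nonneg hab hβ.2 M (i.val + 1) M).2
      (Real.exp_pos (-lam * |((i.val + 1 : ℕ) : ℝ) - (M + 1 : ℕ)| * gH a b M)).le
    linarith

theorem temperedDiff_gX {a b lam : ℝ} (hab : a < b) (u : ℝ → ℝ) (M i j : ℕ) :
    temperedDiff lam u (gX a b M i) (gX a b M j) =
      Real.exp (-lam * |(i : ℝ) - j| * gH a b M) * (u (gX a b M i) - u (gX a b M j)) := by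
  rw [temperedDiff, gX_sub_gX, abs_mul, abs_of_pos (gH_pos hab M)]
  ring_nf

theorem abs_mulVec_sub_loadF_le (a b β lam : ℝ)
    (hab : a < b) (hβ : β ∈ Set.Ioo (0 : ℝ) 1) (hlam : 0 ≤ lam)
    (u g f : ℝ → ℝ)
    (hu : ContDiffOn ℝ 2 u (Set.Icc a b))
    (hg : Measurable g)
    (hug : ∀ x, x ∉ Set.Ioo a b → u x = g x)
    (hgint : ∀ x ∈ Set.Ioo a b,
      IntegrableOn (fun y => |g y| * Real.exp (-lam * |x - y|) * |x - y| ^ (-1 - β))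
        (Set.Ioo a b)ᶜ volume)
    (hf : ∀ x ∈ Set.Ioo a b,
      Filter.Tendsto
        (fun ε : ℝ => ∫ y in {y : ℝ | ε < |x - y|},
          (u x - u y) * Real.exp (-lam * |x - y|) * |x - y| ^ (-1 - β))
        (nhdsWithin 0 (Set.Ioi 0)) (nhds (f x))) :
    ∃ R : ℝ, 0 ≤ R ∧ ∀ M : ℕ, 3 ≤ M → ∀ i : Fin M,
      |(stiff a b β lam 0 0 M).mulVec (fun j => u (gX a b M (j.val + 1))) i -
        loadF a b β lam 0 0 f g u M i| ≤ R * gH a b M ^ (2 - β) := by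
  obtain ⟨u', u'', K, hK0, hu', hu'', hK, hlip⟩ := hu.exists_bounded_derivs hab
  have hC : 0 ≤ K * (2 * lam ^ 2 + 2 * lam + 1) := by positivity
  have h1β : 0 < 1 - β := sub_pos.2 hβ.2
  have hβ0 : 0 < β := hβ.1
  refine ⟨K * (2 * lam ^ 2 + 2 * lam + 1) * (1 / (1 - β) + 1 / β), by positivity, ?_⟩
  intro M hM i
  have hx := gX_mem_Ioo hab (M := M) (i := i.val + 1) (by omega) (by omega)
  have hxI := Ioo_subset_Icc_self hx
  have key := abs_integral_sub_quadrature_le hab hβ hC M (i.val + 1) (by omega) (by omega)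
    (Φ := temperedDiff lam u (gX a b M (i.val + 1))) (by simp [temperedDiff])
    (integrableOn_temperedDiff_mul_rpow hβ hlam hu.continuousOn hxI hlip)
    (fun c d hac hcd hdb hxcd y hy =>
      abs_temperedDiff_sub_interp_le hlam hu.continuousOn hu' hu'' hK hxI hac hcd hdb hxcd hy)
  have hfx := eq_integral_temperedDiff_add hβ hlam hu.continuousOn hx hlip hg hug (hgint _ hx)
    (hf _ hx)
  convert key using 2
  rw [sum_cells_eq _ _ (fun m => temperedDiff lam u (gX a b M (i.val + 1)) (gX a b M m)), loadF_eq,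
    stiff_mulVec _ _ _ _ _ _ (fun j => u (gX a b M j)),
    diagExtra_eq _ _ _ _ _ _ hM (by omega) (by omega), hfx]
  simp only [temperedDiff_gX hab]
  simp only [gX_zero, gX_last, cB1, cB2, dd1, dd2]
  ring

/-- convergence of the finite difference scheme, case `β ∈ (0,1)`, `s = s₁ = 0`,
`u ∈ C²([a,b])`: there are constants `C₁, C₂ > 0`, independent of `M` and `h`, such that for
every `M ≥ 3` the system `H U_h = F` has a unique solution `U_h`, with
`‖U − U_h‖ ≤ C₁ h^{2−β}` and `‖U − U_h‖_∞ ≤ C₂ h^{2−β}`. -/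
theorem scheme_convergence_C2 (a b β lam : ℝ)
    (hab : a < b) (hβ : β ∈ Set.Ioo (0 : ℝ) 1) (hlam : 0 ≤ lam)
    (u g f : ℝ → ℝ)
    (hu : ContDiffOn ℝ 2 u (Set.Icc a b))
    (hg : Measurable g)
    (hug : ∀ x, x ∉ Set.Ioo a b → u x = g x)
    (hgint : ∀ x ∈ Set.Ioo a b,
      IntegrableOn (fun y => |g y| * Real.exp (-lam * |x - y|) * |x - y| ^ (-1 - β))
        (Set.Ioo a b)ᶜ volume)
    (hf : ∀ x ∈ Set.Ioo a b,
      Filter.Tendsto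
        (fun ε : ℝ => ∫ y in {y : ℝ | ε < |x - y|},
          (u x - u y) * Real.exp (-lam * |x - y|) * |x - y| ^ (-1 - β))
        (nhdsWithin 0 (Set.Ioi 0)) (nhds (f x))) :
    ∃ C₁ > (0 : ℝ), ∃ C₂ > (0 : ℝ), ∀ M : ℕ, 3 ≤ M →
      (∃! Uh : Fin M → ℝ,
        (stiff a b β lam 0 0 M).mulVec Uh = loadF a b β lam 0 0 f g u M) ∧
      ∀ Uh : Fin M → ℝ,
        (stiff a b β lam 0 0 M).mulVec Uh = loadF a b β lam 0 0 f g u M →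
          dnorm2 a b M (fun i => u (gX a b M (i.val + 1)) - Uh i)
              ≤ C₁ * gH a b M ^ (2 - β) ∧
            ∀ i : Fin M, |u (gX a b M (i.val + 1)) - Uh i| ≤ C₂ * gH a b M ^ (2 - β) := by
  obtain ⟨R, hR0, hR⟩ := abs_mulVec_sub_loadF_le a b β lam hab hβ hlam u g f hu hg hug hgint hf
  set c := Real.exp (-lam * (b - a + 1)) * (b - a + 1) ^ (-1 - β) with hc
  have hcpos : 0 < c := mul_pos (Real.exp_pos _) (Real.rpow_pos_of_pos (by linarith) _)
  have hba : 0 < b - a := sub_pos.2 hab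
  have hC₂ : 0 < R / c + 1 := by positivity
  refine ⟨Real.sqrt (b - a) * (R / c + 1), by positivity, R / c + 1, hC₂, fun M hM => ?_⟩
  obtain ⟨hunit, hstab⟩ := stiff_isUnit_and_abs_le hab hβ hlam hM
  have hh := gH_pos hab M
  have hpow : 0 < gH a b M ^ (2 - β) := Real.rpow_pos_of_pos hh _
  have hsup : ∀ Uh : Fin M → ℝ,
      (stiff a b β lam 0 0 M).mulVec Uh = loadF a b β lam 0 0 f g u M →
      ∀ i : Fin M, |u (gX a b M (i.val + 1)) - Uh i| ≤ (R / c + 1) * gH a b M ^ (2 - β) := by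
    intro Uh hUh i
    have h := hstab (fun i => u (gX a b M (i.val + 1)) - Uh i) (R * gH a b M ^ (2 - β))
      (fun i => by
        have h1 := hR M hM i
        rw [← hUh, ← Pi.sub_apply, ← Matrix.mulVec_sub] at h1
        exact h1) i
    have h2 : |u (gX a b M (i.val + 1)) - Uh i| ≤ R * gH a b M ^ (2 - β) / c := by
      rw [le_div_iff₀ hcpos, mul_comm]
      exact h
    calc _ ≤ R * gH a b M ^ (2 - β) / c := h2
      _ ≤ R * gH a b M ^ (2 - β) / c + gH a b M ^ (2 - β) := le_add_of_nonneg_right hpow.le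
      _ = _ := by ring
  refine ⟨?_, fun Uh hUh => ⟨?_, hsup Uh hUh⟩⟩
  · obtain ⟨Uh, hUh⟩ := Matrix.mulVec_surjective_iff_isUnit.2 hunit (loadF a b β lam 0 0 f g u M)
    exact ⟨Uh, hUh, fun V hV =>
      Matrix.mulVec_injective_iff_isUnit.2 hunit (hV.trans hUh.symm)⟩
  · set B := (R / c + 1) * gH a b M ^ (2 - β) with hB
    have hB0 : 0 ≤ B := by positivity
    have hsum : ∑ i : Fin M, (u (gX a b M (i.val + 1)) - Uh i) ^ 2 ≤ M * B ^ 2 := by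
      calc _ ≤ ∑ _i : Fin M, B ^ 2 := Finset.sum_le_sum fun i _ => by
            rw [← sq_abs]
            exact pow_le_pow_left₀ (abs_nonneg _) (hsup Uh hUh i) 2
        _ = _ := by simp
    have hhM : gH a b M * M ≤ b - a := by
      rw [gH, div_mul_eq_mul_div, div_le_iff₀ (by positivity)]
      nlinarith
    rw [mul_assoc, ← hB, dnorm2]
    refine Real.sqrt_le_iff.2 ⟨by positivity, ?_⟩
    rw [mul_pow, Real.sq_sqrt hba.le]
    calc _ ≤ gH a b M * (M * B ^ 2) := by gcongr
      _ = gH a b M * M * B ^ 2 := by ring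
      _ ≤ (b - a) * B ^ 2 := by gcongr

end
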